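/- arXiv:1511.03352 — 2 statements merged into one kernel-verified Lean document; each statement's English description precedes it below -/
import Mathlib

section
/- Let n ≥ 1 and let h : ℝ × ℝⁿ → ℝ^{n×n} be a smooth map taking values in real symmetric positive-definite n×n matrices; write x = (x₁, x') ∈ ℝ × ℝⁿ, set h̄(x) = det h(x) and γ(x) = −∂_{x₁}h̄(x)/h̄(x), and for λ ∈ ℂ define the differential operator P(λ)u = −4x₁∂²_{x₁}u + (4iλ − 4)∂_{x₁}u − h̄(x)^{−1/2} Σ_{j,k=1}^n ∂_{x'_j}( h̄(x)^{1/2} (h(x)^{−1})_{jk} ∂_{x'_k}u ) + γ(x)( 2x₁∂_{x₁}u − iλ u + ((n−1)/2) u ) acting on smooth functions u : ℝ^{1+n} → ℂ. If u : ℝ^{1+n} → ℂ is smooth, supp u ⊆ [−1, 0] × K for some compact set K ⊆ ℝⁿ, and P(λ)u = 0 on (−1, 0) × ℝⁿ, then u ≡ 0. -/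
open Complex

/-- Partial derivative in the first variable `x₁` of a function on `ℝ × ℝⁿ`. -/
noncomputable def d1 {n : ℕ} (u : ℝ × (Fin n → ℝ) → ℂ) (x : ℝ × (Fin n → ℝ)) : ℂ :=
  deriv (fun t => u (t, x.2)) x.1

/-- Partial derivative in the variable `x'_j` of a function on `ℝ × ℝⁿ`. -/
noncomputable def dprime {n : ℕ} (j : Fin n) (u : ℝ × (Fin n → ℝ) → ℂ)
    (x : ℝ × (Fin n → ℝ)) : ℂ :=
  deriv (fun t => u (x.1, Function.update x.2 j t)) (x.2 j)

/-- `h̄(x) = det h(x)`. -/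
noncomputable def hbar {n : ℕ} (h : ℝ × (Fin n → ℝ) → Matrix (Fin n) (Fin n) ℝ)
    (x : ℝ × (Fin n → ℝ)) : ℝ :=
  (h x).det

/-- `γ(x) = −∂_{x₁}h̄(x)/h̄(x)`. -/
noncomputable def gam {n : ℕ} (h : ℝ × (Fin n → ℝ) → Matrix (Fin n) (Fin n) ℝ)
    (x : ℝ × (Fin n → ℝ)) : ℝ :=
  -(deriv (fun t => hbar h (t, x.2)) x.1) / hbar h x

/-- The differential operator
`P(λ)u = −4x₁∂²_{x₁}u + (4iλ − 4)∂_{x₁}u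
  − h̄^{−1/2} Σ_{j,k} ∂_{x'_j}( h̄^{1/2} (h⁻¹)_{jk} ∂_{x'_k}u )
  + γ(x)( 2x₁∂_{x₁}u − iλ u + ((n−1)/2) u )`,
where `h̄ = det h` and `γ = −∂_{x₁}h̄/h̄`. -/
noncomputable def Pop {n : ℕ} (h : ℝ × (Fin n → ℝ) → Matrix (Fin n) (Fin n) ℝ) (lam : ℂ)
    (u : ℝ × (Fin n → ℝ) → ℂ) (x : ℝ × (Fin n → ℝ)) : ℂ :=
  -4 * (x.1 : ℂ) * d1 (d1 u) x + (4 * Complex.I * lam - 4) * d1 u x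
    - (((Real.sqrt (hbar h x))⁻¹ : ℝ) : ℂ) *
        ∑ j : Fin n, ∑ k : Fin n,
          dprime j (fun y => ((Real.sqrt (hbar h y) * ((h y)⁻¹ j k) : ℝ) : ℂ) * dprime k u y) x
    + ((gam h x : ℝ) : ℂ) *
        (2 * (x.1 : ℂ) * d1 u x - Complex.I * lam * u x + (((n : ℂ) - 1) / 2) * u x)

open scoped ContDiff
open MeasureTheory

/-- The directional derivative of `f` along the constant vector field `v`. -/
noncomputable def dirDeriv {X F : Type*} [NormedAddCommGroup X] [NormedSpace ℝ X]
    [NormedAddCommGroup F] [NormedSpace ℝ F] (v : X) (f : X → F) (x : X) : F :=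
  fderiv ℝ f x v

section DirDeriv

variable {X F : Type*} [NormedAddCommGroup X] [NormedSpace ℝ X]
  [NormedAddCommGroup F] [NormedSpace ℝ F]

theorem ContDiff.dirDeriv {f : X → F} (hf : ContDiff ℝ ∞ f) (v : X) :
    ContDiff ℝ ∞ (dirDeriv v f) :=
  (hf.fderiv_right (by simp)).clm_apply contDiff_const

theorem dirDeriv_comm {f : X → F} (hf : ContDiff ℝ ∞ f) (v w : X) (x : X) :
    dirDeriv v (dirDeriv w f) x = dirDeriv w (dirDeriv v f) x := by
  have hd : DifferentiableAt ℝ (fderiv ℝ f) x :=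
    ((hf.fderiv_right (m := ∞) (by simp)).differentiable (by simp)) x
  have hs : IsSymmSndFDerivAt ℝ f x :=
    (hf.contDiffAt (x := x)).isSymmSndFDerivAt (by
      rw [minSmoothness_of_isRCLikeNormedField]
      exact WithTop.coe_le_coe.2 (le_top : (2 : ℕ∞) ≤ ⊤))
  have key : ∀ a b : X, dirDeriv a (dirDeriv b f) x = fderiv ℝ (fderiv ℝ f) x a b := by
    intro a b
    have h2 : HasFDerivAt (fun y => fderiv ℝ f y b) ((fderiv ℝ (fderiv ℝ f) x).flip b) x := by
      simpa using hd.hasFDerivAt.clm_apply (hasFDerivAt_const b x)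
    change fderiv ℝ (fun y => fderiv ℝ f y b) x a = _
    rw [h2.fderiv]; rfl
  rw [key, key, hs v w]

theorem dirDeriv_eq_zero_of_isOpen {f : X → F} {s : Set X} (hs : IsOpen s)
    (hf : ∀ x ∈ s, f x = 0) (v : X) : ∀ x ∈ s, dirDeriv v f x = 0 := by
  intro x hx
  have : f =ᶠ[nhds x] fun _ => (0 : F) := by
    filter_upwards [hs.mem_nhds hx] with y hy using hf y hy
  simp [dirDeriv, this.fderiv_eq]

theorem dirDeriv_inner {f g : X → ℂ} (hf : ContDiff ℝ ∞ f) (hg : ContDiff ℝ ∞ g) (v x : X) :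
    dirDeriv v (fun y => inner ℝ (f y) (g y)) x =
      inner ℝ (f x) (dirDeriv v g x) + inner ℝ (dirDeriv v f x) (g x) :=
  fderiv_inner_apply ℝ (hf.differentiable (by simp) x) (hg.differentiable (by simp) x) v

theorem dirDeriv_add {f g : X → F} (hf : ContDiff ℝ ∞ f) (hg : ContDiff ℝ ∞ g) (v x : X) :
    dirDeriv v (fun y => f y + g y) x = dirDeriv v f x + dirDeriv v g x := by
  simp only [dirDeriv]
  rw [fderiv_fun_add (hf.differentiable (by simp) x) (hg.differentiable (by simp) x)]
  rfl

theorem dirDeriv_sum {ι : Type*} (s : Finset ι) {f : ι → X → F}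
    (hf : ∀ i, ContDiff ℝ ∞ (f i)) (v x : X) :
    dirDeriv v (fun y => ∑ i ∈ s, f i y) x = ∑ i ∈ s, dirDeriv v (f i) x := by
  simp only [dirDeriv]
  rw [fderiv_fun_sum fun i _ => (hf i).differentiable (by simp) x]
  simp

theorem dirDeriv_mul {f g : X → ℝ} (hf : ContDiff ℝ ∞ f) (hg : ContDiff ℝ ∞ g) (v x : X) :
    dirDeriv v (fun y => f y * g y) x = dirDeriv v f x * g x + f x * dirDeriv v g x := by
  simp only [dirDeriv]
  rw [fderiv_fun_mul (hf.differentiable (by simp) x) (hg.differentiable (by simp) x)]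
  simp; ring

end DirDeriv

section Slice

variable {E F : Type*} [NormedAddCommGroup E] [NormedSpace ℝ E]
  [NormedAddCommGroup F] [NormedSpace ℝ F]

theorem hasCompactSupport_slice {E : Type*} [TopologicalSpace E] [R1Space E]
    {f : ℝ × E → ℝ} {K : Set E} (hK : IsCompact K)
    (hf0 : ∀ x, x.2 ∉ K → f x = 0) (t : ℝ) : HasCompactSupport fun y => f (t, y) :=
  HasCompactSupport.intro hK fun y hy => hf0 (t, y) hy

theorem dirDeriv_eq_zero_of_notMem {f : ℝ × E → F} {K : Set E} (hK : IsCompact K)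
    (hf0 : ∀ x, x.2 ∉ K → f x = 0) (v : ℝ × E) : ∀ x, x.2 ∉ K → dirDeriv v f x = 0 :=
  dirDeriv_eq_zero_of_isOpen (s := Prod.snd ⁻¹' Kᶜ)
    (hK.isClosed.isOpen_compl.preimage continuous_snd) hf0 v

theorem hasDerivAt_slice_fst {f : ℝ × E → F} (hf : ContDiff ℝ ∞ f) (t : ℝ) (y : E) :
    HasDerivAt (fun s => f (s, y)) (dirDeriv (1, 0) f (t, y)) t :=
  (hf.differentiable (by simp) (t, y)).hasFDerivAt.comp_hasDerivAt t
    ((hasDerivAt_id t).prodMk (hasDerivAt_const t y))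

theorem dirDeriv_slice_snd {f : ℝ × E → F} (hf : ContDiff ℝ ∞ f) (t : ℝ) (y v : E) :
    dirDeriv v (fun z => f (t, z)) y = dirDeriv (0, v) f (t, y) := by
  have h := (hf.differentiable (by simp) (t, y)).hasFDerivAt.comp y
    ((hasFDerivAt_const t y).prodMk (hasFDerivAt_id y))
  change fderiv ℝ (f ∘ fun z => (t, z)) y v = _
  rw [h.fderiv]
  simp [dirDeriv]

end Slice

section Integral

variable {E : Type*} [NormedAddCommGroup E] [NormedSpace ℝ E]
  [MeasurableSpace E] [BorelSpace E] (μ : Measure E) [μ.IsAddHaarMeasure]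

theorem integral_dirDeriv_eq_zero [FiniteDimensional ℝ E] {f : E → ℝ} (hf : ContDiff ℝ ∞ f)
    (hc : HasCompactSupport f) (v : E) : ∫ x, dirDeriv v f x ∂μ = 0 := by
  have hc' : HasCompactSupport (dirDeriv v f) := hc.fderiv_apply (𝕜 := ℝ) v
  have h := integral_mul_fderiv_eq_neg_fderiv_mul_of_integrable (μ := μ) (f := fun _ : E => (1 : ℝ))
    (g := f) (v := v) (by simp)
    (by simpa [dirDeriv] using! (hf.dirDeriv v).continuous.integrable_of_hasCompactSupport hc')
    (by simpa using hf.continuous.integrable_of_hasCompactSupport hc)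
    (fun x _ => differentiableAt_const _) (fun x _ => hf.differentiable (by simp) x)
  simpa [dirDeriv] using h

theorem hasDerivAt_integral_slice {f : ℝ × E → ℝ} (hf : ContDiff ℝ ∞ f) {K : Set E}
    (hK : IsCompact K) (hf0 : ∀ x, x.2 ∉ K → f x = 0) (t : ℝ) :
    HasDerivAt (fun s => ∫ y, f (s, y) ∂μ) (∫ y, dirDeriv (1, 0) f (t, y) ∂μ) t := by
  have hD0 := dirDeriv_eq_zero_of_notMem hK hf0 (1, 0)
  have hDc := (hf.dirDeriv (1, 0)).continuous
  obtain ⟨C, hC⟩ := ((isCompact_Icc (a := t - 1) (b := t + 1)).prod hK).exists_bound_of_continuousOn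
    hDc.continuousOn
  refine (hasDerivAt_integral_of_dominated_loc_of_deriv_le (μ := μ)
    (F := fun s y => f (s, y)) (F' := fun s y => dirDeriv (1, 0) f (s, y))
    (s := Set.Icc (t - 1) (t + 1)) (bound := K.indicator fun _ => C)
    (Icc_mem_nhds (by linarith) (by linarith)) ?_ ?_ ?_ ?_ ?_ ?_).2
  · exact .of_forall fun s =>
      (hf.continuous.comp (Continuous.prodMk_right s)).aestronglyMeasurable
  · exact (hf.continuous.comp (Continuous.prodMk_right t)).integrable_of_hasCompactSupport
      (hasCompactSupport_slice hK hf0 t)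
  · exact (hDc.comp (Continuous.prodMk_right t)).aestronglyMeasurable
  · refine .of_forall fun y s hs => ?_
    by_cases hy : y ∈ K
    · simpa [hy] using hC (s, y) ⟨hs, hy⟩
    · simp [hy, hD0 (s, y) hy]
  · exact (integrable_indicator_iff hK.measurableSet).2
      (integrableOn_const hK.measure_lt_top.ne)
  · exact .of_forall fun y s _ => hasDerivAt_slice_fst hf s y

/-- If `e ≥ 0` vanishes at time `a` and its time derivative is, up to a function with zero
spatial integral, bounded by a multiple of `e`, then `e` vanishes up to time `b`. -/
theorem eq_zero_of_dirDeriv_le {e d : ℝ × E → ℝ} (he : ContDiff ℝ ∞ e) (hd : Continuous d)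
    {K : Set E} (hK : IsCompact K)
    (he0 : ∀ x, x.2 ∉ K → e x = 0) (hd0 : ∀ x, x.2 ∉ K → d x = 0) {a b C : ℝ} (hab : a ≤ b)
    (hnonneg : ∀ t ∈ Set.Icc a b, ∀ y, 0 ≤ e (t, y)) (hinit : ∀ y, e (a, y) = 0)
    (hdint : ∀ t, ∫ y, d (t, y) ∂μ = 0)
    (hle : ∀ t ∈ Set.Ioo a b, ∀ y ∈ K, dirDeriv (1, 0) e (t, y) - d (t, y) ≤ C * e (t, y))
    (y : E) : e (b, y) = 0 := by
  have hint : ∀ {f : ℝ × E → ℝ}, Continuous f → (∀ x, x.2 ∉ K → f x = 0) → ∀ t : ℝ,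
      Integrable (fun y => f (t, y)) μ := fun hf hf0 t =>
    (hf.comp (Continuous.prodMk_right t)).integrable_of_hasCompactSupport
      (hasCompactSupport_slice hK hf0 t)
  have hD0 := dirDeriv_eq_zero_of_notMem hK he0 (1, 0)
  have hDc := (he.dirDeriv (1, 0)).continuous
  have hG : ∀ t, HasDerivAt (fun s => (∫ y, e (s, y) ∂μ) * Real.exp (-C * s))
      ((∫ y, dirDeriv (1, 0) e (t, y) ∂μ) * Real.exp (-C * t) +
        (∫ y, e (t, y) ∂μ) * (Real.exp (-C * t) * (-C * 1))) t := fun t =>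
    (hasDerivAt_integral_slice μ he hK he0 t).mul
      (((hasDerivAt_id t).const_mul (-C)).exp)
  have hbound : ∀ t ∈ Set.Ioo a b,
      ∫ y, dirDeriv (1, 0) e (t, y) ∂μ ≤ C * ∫ y, e (t, y) ∂μ := by
    intro t ht
    rw [← sub_zero (∫ y, dirDeriv (1, 0) e (t, y) ∂μ), ← hdint t,
      ← integral_sub (hint hDc hD0 t) (hint hd hd0 t), ← integral_const_mul]
    refine integral_mono ((hint hDc hD0 t).sub (hint hd hd0 t))
      ((hint he.continuous he0 t).const_mul C) fun y => ?_
    by_cases hy : y ∈ K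
    · exact hle t ht y hy
    · simp [hD0 (t, y) hy, hd0 (t, y) hy, he0 (t, y) hy]
  have hanti : AntitoneOn (fun s => (∫ y, e (s, y) ∂μ) * Real.exp (-C * s)) (Set.Icc a b) := by
    refine antitoneOn_of_deriv_nonpos (convex_Icc a b)
      (fun t _ => (hG t).continuousAt.continuousWithinAt)
      (fun t _ => (hG t).differentiableAt.differentiableWithinAt) fun t ht => ?_
    rw [interior_Icc] at ht
    rw [(hG t).deriv]
    nlinarith [hbound t ht, Real.exp_pos (-C * t)]
  have hfin := hanti (Set.left_mem_Icc.2 hab) (Set.right_mem_Icc.2 hab) hab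
  simp only [hinit, integral_zero, zero_mul] at hfin
  have hfin' : ∫ y, e (b, y) ∂μ ≤ 0 := nonpos_of_mul_nonpos_left hfin (Real.exp_pos _)
  by_contra hne
  exact hfin'.not_gt <| Continuous.integral_pos_of_hasCompactSupport_nonneg_nonzero (x := y)
    (he.continuous.comp (Continuous.prodMk_right b)) (hasCompactSupport_slice hK he0 b)
    (hnonneg b (Set.right_mem_Icc.2 hab)) hne

end Integral

section QuadraticForm

theorem exists_quadForm_le {X : Type*} [TopologicalSpace X] {n : ℕ} {S : Set X}
    (hS : IsCompact S) {A B : Fin n → Fin n → X → ℝ} (hA : ∀ j k, Continuous (A j k))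
    (hB : ∀ j k, Continuous (B j k))
    (hpos : ∀ x ∈ S, ∀ ξ : Fin n → ℝ, ξ ≠ 0 → 0 < ∑ j, ∑ k, A j k x * (ξ j * ξ k)) :
    ∃ C : ℝ, 0 ≤ C ∧ ∀ x ∈ S, ∀ ξ : Fin n → ℝ,
      ∑ j, ∑ k, B j k x * (ξ j * ξ k) ≤ C * ∑ j, ∑ k, A j k x * (ξ j * ξ k) := by
  have hne : ∀ ξ ∈ Metric.sphere (0 : Fin n → ℝ) 1, ξ ≠ 0 :=
    fun ξ hξ => ne_zero_of_mem_unit_sphere ⟨ξ, hξ⟩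
  obtain ⟨C, hC⟩ := (hS.prod (isCompact_sphere (0 : Fin n → ℝ) 1)).exists_bound_of_continuousOn
    (f := fun p : X × (Fin n → ℝ) => (∑ j, ∑ k, B j k p.1 * (p.2 j * p.2 k)) /
      ∑ j, ∑ k, A j k p.1 * (p.2 j * p.2 k))
    (ContinuousOn.div (by fun_prop) (by fun_prop)
      fun p hp => (hpos p.1 hp.1 p.2 (hne _ hp.2)).ne')
  refine ⟨max C 0, le_max_right _ _, fun x hx ξ => ?_⟩
  by_cases hξ : ξ = 0
  · simp [hξ]
  have hnorm : 0 < ‖ξ‖ := norm_pos_iff.2 hξ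
  set η : Fin n → ℝ := ‖ξ‖⁻¹ • ξ with hη
  have hηs : η ∈ Metric.sphere (0 : Fin n → ℝ) 1 := by
    simp [hη, norm_smul, hnorm.ne']
  have hscale : ∀ M : Fin n → Fin n → X → ℝ, ∑ j, ∑ k, M j k x * (ξ j * ξ k) =
      ‖ξ‖ ^ 2 * ∑ j, ∑ k, M j k x * (η j * η k) := by
    intro M
    simp only [Finset.mul_sum, hη, Pi.smul_apply, smul_eq_mul]
    refine Finset.sum_congr rfl fun j _ => Finset.sum_congr rfl fun k _ => ?_
    field_simp
  have hApos := hpos x hx η (hne _ hηs)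
  have h1 : (∑ j, ∑ k, B j k x * (η j * η k)) ≤ max C 0 * ∑ j, ∑ k, A j k x * (η j * η k) := by
    rw [← div_le_iff₀ hApos]
    exact ((le_abs_self _).trans (hC (x, η) ⟨hx, hηs⟩)).trans (le_max_left _ _)
  rw [hscale B, hscale A, mul_left_comm]
  gcongr

theorem sum_mul_inner_eq {n : ℕ} (M : Fin n → Fin n → ℝ) (z : Fin n → ℂ) :
    ∑ j, ∑ k, M j k * inner ℝ (z j) (z k) =
      ∑ j, ∑ k, M j k * ((z j).re * (z k).re) + ∑ j, ∑ k, M j k * ((z j).im * (z k).im) := by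
  simp only [← Finset.sum_add_distrib]
  refine Finset.sum_congr rfl fun j _ => Finset.sum_congr rfl fun k _ => ?_
  rw [Complex.inner]
  simp
  ring

end QuadraticForm
section WaveEquation

theorem dirDeriv_energy_sub_eq {X : Type*} [NormedAddCommGroup X] [NormedSpace ℝ X] {n : ℕ}
    {A : Fin n → Fin n → X → ℝ} {m : X → ℝ} {u : X → ℂ} (hA : ∀ j k, ContDiff ℝ ∞ (A j k))
    (hsymm : ∀ j k x, A j k x = A k j x) (hm : ContDiff ℝ ∞ m) (hu : ContDiff ℝ ∞ u)
    (τ : X) (v : Fin n → X) (x : X) :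
    dirDeriv τ (fun y => m y * inner ℝ (dirDeriv τ u y) (dirDeriv τ u y) +
        ∑ j, ∑ k, A j k y * inner ℝ (dirDeriv (v j) u y) (dirDeriv (v k) u y) +
        inner ℝ (u y) (u y)) x -
      ∑ j, ∑ k, 2 * dirDeriv (v j)
        (fun y => inner ℝ (dirDeriv τ u y) (A j k y • dirDeriv (v k) u y)) x =
    dirDeriv τ m x * inner ℝ (dirDeriv τ u x) (dirDeriv τ u x) +
      2 * inner ℝ (dirDeriv τ u x) (m x • dirDeriv τ (dirDeriv τ u) x -
        ∑ j, ∑ k, dirDeriv (v j) (fun y => A j k y • dirDeriv (v k) u y) x) +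
      ∑ j, ∑ k, dirDeriv τ (A j k) x * inner ℝ (dirDeriv (v j) u x) (dirDeriv (v k) u x) +
      2 * inner ℝ (u x) (dirDeriv τ u x) := by
  have hD := fun w => hu.dirDeriv w
  have hI : ∀ w w', ContDiff ℝ ∞ fun y => (inner ℝ (dirDeriv w u y) (dirDeriv w' u y) : ℝ) :=
    fun w w' => (hD w).inner ℝ (hD w')
  have hAI : ∀ j k, ContDiff ℝ ∞ fun y =>
      A j k y * (inner ℝ (dirDeriv (v j) u y) (dirDeriv (v k) u y) : ℝ) :=
    fun j k => (hA j k).mul (hI _ _)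
  have hsum : ∀ j, ContDiff ℝ ∞ fun y =>
      ∑ k, A j k y * (inner ℝ (dirDeriv (v j) u y) (dirDeriv (v k) u y) : ℝ) :=
    fun j => ContDiff.sum fun k _ => hAI j k
  have hswap : ∑ j, ∑ k, A j k x *
        (inner ℝ (dirDeriv (v j) u x) (dirDeriv τ (dirDeriv (v k) u) x) : ℝ) =
      ∑ j, ∑ k, A j k x * inner ℝ (dirDeriv τ (dirDeriv (v j) u) x) (dirDeriv (v k) u x) := by
    rw [Finset.sum_comm]
    refine Finset.sum_congr rfl fun j _ => Finset.sum_congr rfl fun k _ => ?_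
    rw [hsymm, real_inner_comm]
  have hflux : ∀ j k, dirDeriv (v j)
      (fun y => (inner ℝ (dirDeriv τ u y) (A j k y • dirDeriv (v k) u y) : ℝ)) x =
      inner ℝ (dirDeriv τ u x) (dirDeriv (v j) (fun y => A j k y • dirDeriv (v k) u y) x) +
      A j k x * inner ℝ (dirDeriv τ (dirDeriv (v j) u) x) (dirDeriv (v k) u x) := by
    intro j k
    rw [dirDeriv_inner (g := fun y => A j k y • dirDeriv (v k) u y) (hD τ)
      ((hA j k).smul (hD (v k))), dirDeriv_comm hu (v j) τ,
      real_inner_smul_right]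
  rw [dirDeriv_add ((hm.mul (hI τ τ)).add (ContDiff.sum fun j _ => hsum j)) (hu.inner ℝ hu),
    dirDeriv_add (hm.mul (hI τ τ)) (ContDiff.sum fun j _ => hsum j),
    dirDeriv_sum _ hsum, dirDeriv_mul hm (hI τ τ), dirDeriv_inner (hD τ) (hD τ),
    dirDeriv_inner hu hu]
  simp only [hflux]
  simp only [dirDeriv_sum _ (hAI _), dirDeriv_mul (hA _ _) (hI _ _),
    dirDeriv_inner (hD _) (hD _), mul_add, Finset.sum_add_distrib, ← Finset.mul_sum, hswap,
    inner_sub_right, inner_sum, real_inner_smul_right,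
    real_inner_comm (dirDeriv τ u x) (dirDeriv τ (dirDeriv τ u) x),
    real_inner_comm (u x) (dirDeriv τ u x)]
  ring

theorem energy_density_bound {p q m m' a α β M N C I₁ I₂ I₃ Q Q' : ℝ}
    (hm : 0 ≤ m) (hβ : 0 ≤ β) (hM0 : 0 ≤ M) (hC : 0 ≤ C)
    (hM : α + β + a + 1 ≤ M * m) (hN : β ≤ N) (ha : 0 ≤ a) (hm' : m' ≤ a) (h₁ : I₁ ≤ p * (α * p))
    (h₂ : I₂ ≤ p * (β * q)) (h₃ : I₃ ≤ q * p) (hQ' : Q' ≤ C * Q) (hQ : 0 ≤ Q) :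
    m' * p ^ 2 + 2 * (I₁ + I₂) + Q' + 2 * I₃ ≤
      (C + 3 * M + N + 1) * (m * p ^ 2 + Q + q ^ 2) := by
  have hN0 : 0 ≤ N := hβ.trans hN
  have hp2 : 0 ≤ p ^ 2 := sq_nonneg p
  have hq2 : 0 ≤ q ^ 2 := sq_nonneg q
  have h2pq : 2 * (p * q) ≤ p ^ 2 + q ^ 2 := by linarith [two_mul_le_add_sq p q]
  have hβpq : β * (2 * (p * q)) ≤ β * (p ^ 2 + q ^ 2) := mul_le_mul_of_nonneg_left h2pq hβ
  have hβq : β * q ^ 2 ≤ N * q ^ 2 := mul_le_mul_of_nonneg_right hN hq2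
  have hm'p : m' * p ^ 2 ≤ a * p ^ 2 := mul_le_mul_of_nonneg_right hm' hp2
  have hMp : (α + β + a + 1) * p ^ 2 ≤ M * m * p ^ 2 := mul_le_mul_of_nonneg_right hM hp2
  have hlow : m' * p ^ 2 + 2 * (I₁ + I₂) + Q' + 2 * I₃ ≤
      2 * (M * m * p ^ 2) + (N + 1) * q ^ 2 + C * Q := by
    have h4 : 0 ≤ β * p ^ 2 := by positivity
    have h5 : 0 ≤ a * p ^ 2 := by positivity
    linear_combination hm'p + 2 * h₁ + 2 * h₂ + 2 * h₃ + hQ' + h2pq + hβpq + hβq + 2 * hMp + h4 +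
      h5 + hp2
  have h6 : 0 ≤ M * (m * p ^ 2) := by positivity
  have h7 : 0 ≤ (C + N + 1) * (m * p ^ 2) := by positivity
  have h8 : 0 ≤ (3 * M + N + 1) * Q := by positivity
  have h9 : 0 ≤ (C + 3 * M) * q ^ 2 := by positivity
  linear_combination hlow + h6 + h7 + h8 + h9

/-- Uniqueness for the Cauchy problem for a second order wave equation with smooth coefficients,
for solutions with spatially compact support. -/
theorem eq_zero_of_wave_equation {n : ℕ} {A : Fin n → Fin n → ℝ × (Fin n → ℝ) → ℝ}
    {m : ℝ × (Fin n → ℝ) → ℝ} {u α β : ℝ × (Fin n → ℝ) → ℂ} (hA : ∀ j k, ContDiff ℝ ∞ (A j k))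
    (hsymm : ∀ j k x, A j k x = A k j x)
    (hApos : ∀ x, ∀ ξ : Fin n → ℝ, ξ ≠ 0 → 0 < ∑ j, ∑ k, A j k x * (ξ j * ξ k))
    (hm : ContDiff ℝ ∞ m) (hu : ContDiff ℝ ∞ u) (hα : Continuous α) (hβ : Continuous β)
    {K : Set (Fin n → ℝ)} (hK : IsCompact K) (hu0 : ∀ x, x.2 ∉ K → u x = 0) {a b : ℝ}
    (hab : a ≤ b) (hmpos : ∀ t ∈ Set.Icc a b, ∀ y, 0 < m (t, y))
    (hpast : ∀ x, x.1 < a → u x = 0)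
    (heq : ∀ t ∈ Set.Ioo a b, ∀ y, m (t, y) • dirDeriv (1, 0) (dirDeriv (1, 0) u) (t, y) -
      ∑ j, ∑ k, dirDeriv (0, Pi.single j 1)
        (fun z => A j k z • dirDeriv (0, Pi.single k 1) u z) (t, y) =
      α (t, y) * dirDeriv (1, 0) u (t, y) + β (t, y) * u (t, y)) (y : Fin n → ℝ) :
    u (b, y) = 0 := by
  have hD := fun w => hu.dirDeriv w
  have hD0 := fun w => dirDeriv_eq_zero_of_notMem hK hu0 w
  have hinit : ∀ {f : ℝ × (Fin n → ℝ) → ℂ}, Continuous f → (∀ x, x.1 < a → f x = 0) →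
      ∀ y, f (a, y) = 0 := by
    intro f hf hf0 y
    have hcl : IsClosed {t | f (t, y) = 0} :=
      isClosed_eq (hf.comp (Continuous.prodMk_left y)) continuous_const
    have hsub : closure (Set.Iio a) ⊆ {t | f (t, y) = 0} :=
      closure_minimal (fun t ht => hf0 (t, y) ht) hcl
    rw [closure_Iio] at hsub
    exact hsub (Set.mem_Iic.2 le_rfl)
  have hDinit : ∀ w y, dirDeriv w u (a, y) = 0 := fun w => hinit (hD w).continuous
    (dirDeriv_eq_zero_of_isOpen (isOpen_Iio.preimage continuous_fst) hpast w)
  have hApos' : ∀ x (z : Fin n → ℂ), 0 ≤ ∑ j, ∑ k, A j k x * (inner ℝ (z j) (z k) : ℝ) := by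
    have hnn : ∀ x (ξ : Fin n → ℝ), 0 ≤ ∑ j, ∑ k, A j k x * (ξ j * ξ k) := by
      intro x ξ
      by_cases hξ : ξ = 0
      · simp [hξ]
      · exact (hApos x ξ hξ).le
    intro x z
    rw [sum_mul_inner_eq fun j k => A j k x]
    exact add_nonneg (hnn x fun j => (z j).re) (hnn x fun j => (z j).im)
  have hS : IsCompact (Set.Icc a b ×ˢ K) := isCompact_Icc.prod hK
  obtain ⟨C₁, hC₁, hquad⟩ := exists_quadForm_le hS (fun j k => (hA j k).continuous)
    (fun j k => ((hA j k).dirDeriv (1, 0)).continuous) fun x _ => hApos x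
  have hquad' : ∀ x ∈ Set.Icc a b ×ˢ K, ∀ z : Fin n → ℂ,
      ∑ j, ∑ k, dirDeriv (1, 0) (A j k) x * (inner ℝ (z j) (z k) : ℝ) ≤
        C₁ * ∑ j, ∑ k, A j k x * (inner ℝ (z j) (z k) : ℝ) := by
    intro x hx z
    rw [sum_mul_inner_eq fun j k => A j k x, sum_mul_inner_eq fun j k => dirDeriv (1, 0) (A j k) x,
      mul_add]
    exact add_le_add (hquad x hx fun j => (z j).re) (hquad x hx fun j => (z j).im)
  obtain ⟨M, hM⟩ := hS.exists_bound_of_continuousOn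
    (f := fun x => (‖α x‖ + ‖β x‖ + |dirDeriv (1, 0) m x| + 1) / m x)
    (ContinuousOn.div (by have := (hm.dirDeriv (1, 0)).continuous; fun_prop)
      hm.continuous.continuousOn fun x hx => (hmpos x.1 hx.1 x.2).ne')
  obtain ⟨N, hN⟩ := hS.exists_bound_of_continuousOn (f := fun x => ‖β x‖) (by fun_prop)
  set e : ℝ × (Fin n → ℝ) → ℝ := fun y => m y * inner ℝ (dirDeriv (1, 0) u y) (dirDeriv (1, 0) u y)
    + ∑ j, ∑ k, A j k y * inner ℝ (dirDeriv (0, Pi.single j 1) u y)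
        (dirDeriv (0, Pi.single k 1) u y) + inner ℝ (u y) (u y) with he_def
  set F : Fin n → Fin n → ℝ × (Fin n → ℝ) → ℝ := fun j k y =>
    inner ℝ (dirDeriv (1, 0) u y) (A j k y • dirDeriv (0, Pi.single k 1) u y) with hF_def
  have hF : ∀ j k, ContDiff ℝ ∞ (F j k) := fun j k => (hD _).inner ℝ ((hA j k).smul (hD _))
  have hF0 : ∀ j k x, x.2 ∉ K → F j k x = 0 := fun j k x hx => by simp [hF_def, hD0 _ x hx]
  have he : ContDiff ℝ ∞ e :=
    ((hm.mul ((hD _).inner ℝ (hD _))).add (ContDiff.sum fun j _ => ContDiff.sum fun k _ =>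
      (hA j k).mul ((hD _).inner ℝ (hD _)))).add (hu.inner ℝ hu)
  have hzero : e (b, y) = 0 := by
    refine eq_zero_of_dirDeriv_le volume (C := C₁ + 3 * M + N + 1) he
      (d := fun x => ∑ j, ∑ k, 2 * dirDeriv (0, Pi.single j 1) (F j k) x)
      (continuous_finsetSum _ fun j _ => continuous_finsetSum _ fun k _ =>
        continuous_const.mul ((hF j k).dirDeriv _).continuous) hK
      (fun x hx => by simp [he_def, hD0 _ x hx, hu0 x hx])
      (fun x hx => by simp [dirDeriv_eq_zero_of_notMem hK (hF0 _ _) _ x hx]) hab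
      ?_ ?_ ?_ ?_ y
    · intro t ht y
      exact add_nonneg (add_nonneg (mul_nonneg (hmpos t ht y).le real_inner_self_nonneg)
        (hApos' (t, y) fun j => dirDeriv (0, Pi.single j 1) u (t, y))) real_inner_self_nonneg
    · intro y
      simp [he_def, hDinit, hinit hu.continuous hpast]
    · intro t
      have hFs : ∀ j k, ContDiff ℝ ∞ fun z => F j k (t, z) := fun j k =>
        (hF j k).comp (contDiff_prodMk_right t)
      have hFc : ∀ j k, HasCompactSupport fun z => F j k (t, z) := fun j k =>
        hasCompactSupport_slice hK (hF0 j k) t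
      have hint : ∀ j k, Integrable fun z => 2 * dirDeriv (0, Pi.single j 1) (F j k) (t, z) := by
        intro j k
        refine Integrable.const_mul ?_ 2
        exact (((hF j k).dirDeriv _).continuous.comp
          (Continuous.prodMk_right t)).integrable_of_hasCompactSupport
          (hasCompactSupport_slice hK (dirDeriv_eq_zero_of_notMem hK (hF0 j k) _) t)
      rw [integral_finsetSum _ fun j _ => integrable_finsetSum _ fun k _ => hint j k]
      refine Finset.sum_eq_zero fun j _ => ?_
      rw [integral_finsetSum _ fun k _ => hint j k]
      refine Finset.sum_eq_zero fun k _ => ?_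
      rw [integral_const_mul]
      simp only [← dirDeriv_slice_snd (hF j k)]
      rw [integral_dirDeriv_eq_zero volume (hFs j k) (hFc j k), mul_zero]
    · intro t ht y hy
      have hx : (t, y) ∈ Set.Icc a b ×ˢ K := ⟨Set.Ioo_subset_Icc_self ht, hy⟩
      have hid := dirDeriv_energy_sub_eq hA hsymm hm hu (1, 0) (fun j => (0, Pi.single j 1)) (t, y)
      rw [heq t ht y] at hid
      rw [hid]
      have hmt := hmpos t hx.1 y
      have hM' := (le_abs_self _).trans (hM _ hx)
      rw [div_le_iff₀ hmt] at hM'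
      have hN' := (le_abs_self _).trans (hN _ hx)
      have hQ := hquad' (t, y) hx fun j => dirDeriv (0, Pi.single j 1) u (t, y)
      have hQ0 := hApos' (t, y) fun j => dirDeriv (0, Pi.single j 1) u (t, y)
      simp only [he_def, inner_add_right]
      have hi₁ := real_inner_le_norm (dirDeriv (1, 0) u (t, y))
        (α (t, y) * dirDeriv (1, 0) u (t, y))
      have hi₂ := real_inner_le_norm (dirDeriv (1, 0) u (t, y)) (β (t, y) * u (t, y))
      have hi₃ := real_inner_le_norm (u (t, y)) (dirDeriv (1, 0) u (t, y))
      rw [norm_mul] at hi₁ hi₂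
      have hmD := le_abs_self (dirDeriv (1, 0) m (t, y))
      simp only [real_inner_self_eq_norm_sq]
      have hM0 : 0 ≤ M := by
        by_contra hM0
        nlinarith [norm_nonneg (α (t, y)), norm_nonneg (β (t, y)),
          abs_nonneg (dirDeriv (1, 0) m (t, y))]
      exact energy_density_bound hmt.le (norm_nonneg (β (t, y))) hM0 hC₁ hM' hN' (abs_nonneg _) hmD
        hi₁ hi₂ hi₃ hQ hQ0
  have hb : b ∈ Set.Icc a b := Set.right_mem_Icc.2 hab
  have h1 := mul_nonneg (hmpos b hb y).le
    (real_inner_self_nonneg (x := dirDeriv (1, 0) u (b, y)))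
  have h2 := hApos' (b, y) fun j => dirDeriv (0, Pi.single j 1) u (b, y)
  have h3 := real_inner_self_nonneg (x := u (b, y))
  simp only [he_def] at hzero
  exact inner_self_eq_zero (𝕜 := ℝ).1 (by linarith)

end WaveEquation
section Coefficients

variable {X : Type*} [NormedAddCommGroup X] [NormedSpace ℝ X] {n : ℕ}

theorem Matrix.contDiff_det {h : X → Matrix (Fin n) (Fin n) ℝ}
    (hh : ∀ i j, ContDiff ℝ ∞ fun x => h x i j) : ContDiff ℝ ∞ fun x => (h x).det := by
  simp only [Matrix.det_apply']
  exact ContDiff.sum fun σ _ => contDiff_const.mul (contDiff_prod fun i _ => hh _ _)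

theorem Matrix.contDiff_inv_apply {h : X → Matrix (Fin n) (Fin n) ℝ}
    (hh : ∀ i j, ContDiff ℝ ∞ fun x => h x i j) (hdet : ∀ x, (h x).det ≠ 0) (j k : Fin n) :
    ContDiff ℝ ∞ fun x => (h x)⁻¹ j k := by
  simp only [Matrix.inv_def, Ring.inverse_eq_inv', Matrix.smul_apply, smul_eq_mul,
    Matrix.adjugate_apply]
  refine ((Matrix.contDiff_det hh).inv hdet).mul (Matrix.contDiff_det fun i l => ?_)
  simp only [Matrix.updateRow_apply]
  split_ifs
  · exact contDiff_const
  · exact hh i l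

theorem d1_eq_dirDeriv {u : ℝ × (Fin n → ℝ) → ℂ} (hu : ContDiff ℝ ∞ u) :
    d1 u = dirDeriv (1, 0) u :=
  funext fun x => (hasDerivAt_slice_fst hu x.1 x.2).deriv

theorem dprime_eq_dirDeriv {u : ℝ × (Fin n → ℝ) → ℂ} (hu : ContDiff ℝ ∞ u) (j : Fin n) :
    dprime j u = dirDeriv (0, Pi.single j 1) u := by
  funext x
  have hx : HasFDerivAt u (fderiv ℝ u x) (x.1, Function.update x.2 j (x.2 j)) := by
    rw [Function.update_eq_self]
    exact (hu.differentiable (by simp) x).hasFDerivAt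
  exact (hx.comp_hasDerivAt (x.2 j)
    ((hasDerivAt_const (x.2 j) x.1).prodMk (hasDerivAt_update x.2 j (x.2 j)))).deriv

theorem contDiff_gam {h : ℝ × (Fin n → ℝ) → Matrix (Fin n) (Fin n) ℝ}
    (hh : ∀ i j, ContDiff ℝ ∞ fun x => h x i j) (hdet : ∀ x, (h x).det ≠ 0) :
    ContDiff ℝ ∞ (gam h) := by
  have hbar_smooth : ContDiff ℝ ∞ (hbar h) := Matrix.contDiff_det hh
  have hgam : gam h = fun x => -(dirDeriv (1, 0) (hbar h) x) / hbar h x :=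
    funext fun x => by rw [gam, (hasDerivAt_slice_fst hbar_smooth x.1 x.2).deriv]
  rw [hgam]
  exact (hbar_smooth.dirDeriv _).neg.div hbar_smooth hdet

theorem Matrix.PosDef.sum_mul_pos {M : Matrix (Fin n) (Fin n) ℝ} (hM : M.PosDef)
    {ξ : Fin n → ℝ} (hξ : ξ ≠ 0) : 0 < ∑ j, ∑ k, M j k * (ξ j * ξ k) := by
  have h := hM.dotProduct_mulVec_pos hξ
  simp only [dotProduct, Matrix.mulVec, Finset.mul_sum] at h
  refine h.trans_eq (Finset.sum_congr rfl fun j _ => Finset.sum_congr rfl fun k _ => ?_)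
  rw [Pi.star_apply, star_trivial]
  ring

end Coefficients

/-- Lemma 3.1 of the paper (coordinate version): a smooth function supported in
`[−1,0] × K` (with `K` compact) annihilated by `P(λ)` on `(−1,0) × ℝⁿ`
vanishes identically. -/
theorem stmt0 {n : ℕ} (hn : 1 ≤ n)
    (h : ℝ × (Fin n → ℝ) → Matrix (Fin n) (Fin n) ℝ)
    (hsmooth : ∀ i j : Fin n, ContDiff ℝ (⊤ : ℕ∞) (fun x => h x i j))
    (hsymm : ∀ x, (h x).IsSymm) (hpd : ∀ x, (h x).PosDef)
    (lam : ℂ) (u : ℝ × (Fin n → ℝ) → ℂ) (hu : ContDiff ℝ (⊤ : ℕ∞) u)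
    (K : Set (Fin n → ℝ)) (hK : IsCompact K)
    (hsupp : Function.support u ⊆ Set.Icc (-1 : ℝ) 0 ×ˢ K)
    (hP : ∀ x : ℝ × (Fin n → ℝ), x.1 ∈ Set.Ioo (-1 : ℝ) 0 → Pop h lam u x = 0) :
    u = 0 := by
  have hdet : ∀ x, 0 < (h x).det := fun x => (hpd x).det_pos
  have hw : ContDiff ℝ ∞ fun x => Real.sqrt (hbar h x) :=
    (Matrix.contDiff_det hsmooth).sqrt fun x => (hdet x).ne'
  have hwpos : ∀ x, 0 < Real.sqrt (hbar h x) := fun x => Real.sqrt_pos.2 (hdet x)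
  have hA : ∀ j k, ContDiff ℝ ∞ fun x => Real.sqrt (hbar h x) * (h x)⁻¹ j k := fun j k =>
    hw.mul (Matrix.contDiff_inv_apply hsmooth (fun x => (hdet x).ne') j k)
  have hgam := (contDiff_gam hsmooth fun x => (hdet x).ne').continuous
  have hwc := hw.continuous
  have hneg : ∀ t < 0, ∀ y, u (t, y) = 0 := by
    intro t ht y
    rcases lt_or_ge t (-1) with ht' | ht'
    · by_contra hne
      exact absurd (hsupp hne).1.1 (not_le.2 ht')
    refine eq_zero_of_wave_equation (A := fun j k x => Real.sqrt (hbar h x) * (h x)⁻¹ j k)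
      (m := fun x => -4 * x.1 * Real.sqrt (hbar h x))
      (α := fun x => -(Real.sqrt (hbar h x) : ℂ) *
        ((4 * Complex.I * lam - 4) + (gam h x : ℂ) * (2 * (x.1 : ℂ))))
      (β := fun x => -(Real.sqrt (hbar h x) : ℂ) *
        ((gam h x : ℂ) * (-(Complex.I * lam) + ((n : ℂ) - 1) / 2)))
      hA ?_ ?_ ((contDiff_const.mul contDiff_fst).mul hw) hu (by fun_prop) (by fun_prop) hK ?_ ht'
      ?_ ?_ ?_ y
    · intro j k x
      rw [((hsymm x).inv).apply]
    · intro x ξ hξ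
      simp only [mul_assoc, ← Finset.mul_sum]
      exact mul_pos (hwpos x) ((hpd x).inv.sum_mul_pos hξ)
    · intro x hx
      by_contra hne
      exact hx (hsupp hne).2
    · intro s hs y
      have : s < 0 := hs.2.trans_lt ht
      exact mul_pos (by simp; linarith) (hwpos _)
    · intro x hx
      by_contra hne
      exact absurd (hsupp hne).1.1 (not_le.2 hx)
    · intro s hs y
      have hPs := hP (s, y) ⟨hs.1, hs.2.trans ht⟩
      have hflux : ∀ j k : Fin n,
          dprime j (fun y => ((Real.sqrt (hbar h y) * ((h y)⁻¹ j k) : ℝ) : ℂ) * dprime k u y) =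
          dirDeriv (0, Pi.single j 1)
            (fun x => (Real.sqrt (hbar h x) * (h x)⁻¹ j k) • dirDeriv (0, Pi.single k 1) u x) := by
        intro j k
        have hsmul : ContDiff ℝ ∞ fun x =>
            (Real.sqrt (hbar h x) * (h x)⁻¹ j k) • dirDeriv (0, Pi.single k 1) u x :=
          (hA j k).smul (hu.dirDeriv _)
        rw [← dprime_eq_dirDeriv hsmul, dprime_eq_dirDeriv hu k]
        simp only [Complex.real_smul]
      rw [Pop, d1_eq_dirDeriv hu, d1_eq_dirDeriv (hu.dirDeriv _)] at hPs
      simp only [hflux] at hPs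
      have hw0 : (Real.sqrt (hbar h (s, y)) : ℂ) ≠ 0 := by exact_mod_cast (hwpos (s, y)).ne'
      rw [Complex.real_smul]
      push_cast at hPs ⊢
      field_simp at hPs
      linear_combination hPs / 2
  funext ⟨t, y⟩
  rcases lt_trichotomy t 0 with ht | rfl | ht
  · exact hneg t ht y
  · have hcl : IsClosed {t | u (t, y) = 0} :=
      isClosed_eq (hu.continuous.comp (Continuous.prodMk_left y)) continuous_const
    have hsub := closure_minimal (fun t ht => hneg t ht y : Set.Iio 0 ⊆ {t | u (t, y) = 0}) hcl
    rw [closure_Iio] at hsub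
    exact hsub (Set.mem_Iic.2 le_rfl)
  · by_contra hne
    exact absurd (hsupp hne).1.2 (not_le.2 ht)
end

section
/- Let μ ∈ ℂ with Im μ ≤ 0, let γ : ℝ → ℂ be smooth, let c ∈ ℂ, let m ∈ ℕ, and let c₀, …, c_m ∈ ℂ with c_m ≠ 0. Define the distribution w = Σ_{k=0}^m c_k δ^{(k)} on ℝ and let P act on distributions by the transpose action (P w)(φ) = w( −4(xφ)″ − 4(iμ − 1)φ′ − 2(x γ φ)′ + (c − iμ) γ φ ), corresponding to the operator P = 4(x D_x² − (μ + i)D_x) + i γ(x)(2x D_x − μ − i c) with D_x = −i d/dx. Then P w ≠ 0; that is, there exists φ ∈ C_c^∞(ℝ; ℂ) with (P w)(φ) ≠ 0. -/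
open Complex
open scoped Topology ContDiff

/-- The Taylor coefficients at `0` of `x ^ n * g x` up to order `n`. -/
lemma iteratedDeriv_ofReal_pow_mul_zero (k n : ℕ) (hkn : k ≤ n) (g : ℝ → ℂ)
    (hg : ContDiff ℝ ∞ g) :
    iteratedDeriv k (fun x : ℝ => (x : ℂ) ^ n * g x) 0 =
      if k = n then (n.factorial : ℂ) * g 0 else 0 := by
  induction k generalizing n g with
  | zero =>
    rcases n with _ | n
    · simp
    · simp
  | succ k ih =>
    obtain ⟨n, rfl⟩ : ∃ j, n = j + 1 := ⟨n - 1, by omega⟩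
    have hg' : ContDiff ℝ ∞ (deriv g) := (contDiff_infty_iff_deriv.1 hg).2
    have hd : deriv (fun x : ℝ => (x : ℂ) ^ (n + 1) * g x) =
        fun x : ℝ => (x : ℂ) ^ n * (((n : ℂ) + 1) * g x + (x : ℂ) * deriv g x) := by
      funext x
      have h1 : HasDerivAt (fun x : ℝ => (x : ℂ) ^ (n + 1)) (((n + 1 : ℕ) : ℂ) * (x : ℂ) ^ n) x := by
        simpa using (hasDerivAt_pow (n + 1) (x : ℂ)).comp_ofReal
      have h2 : HasDerivAt g (deriv g x) x :=
        ((hg.differentiable (by simp)) x).hasDerivAt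
      rw [(h1.fun_mul h2).deriv]
      push_cast
      ring
    rw [iteratedDeriv_succ', hd, ih n (by omega) (fun x => ((n : ℂ) + 1) * g x + (x : ℂ) * deriv g x)
      ((contDiff_const.mul hg).add (ofRealCLM.contDiff.mul hg'))]
    by_cases h : k = n
    · simp [h, Nat.factorial_succ]
      ring
    · simp [h]

lemma deriv_ofReal_pow (n : ℕ) (y : ℝ) :
    deriv (fun x : ℝ => (x : ℂ) ^ (n + 1)) y = ((n : ℂ) + 1) * (y : ℂ) ^ n := by
  simpa using ((hasDerivAt_pow (n + 1) (y : ℂ)).comp_ofReal).deriv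

/-- Key step in the proof of Theorem 3: no nonzero distribution
`w = Σ_{k=0}^m c_k δ^{(k)}` supported at `x₁ = 0` is annihilated by
`P = 4(x D² − (μ + i)D) + iγ(x)(2x D − μ − ic)` when `Im μ ≤ 0`; here `P` acts
by the transpose action
`(P w)(φ) = w(−4(xφ)″ − 4(iμ−1)φ′ − 2(xγφ)′ + (c−iμ)γφ)` and
`δ^{(k)}(ψ) = (−1)^k ψ^{(k)}(0)`. -/
theorem stmt5 (μ : ℂ) (hμ : μ.im ≤ 0) (γ : ℝ → ℂ) (hγ : ContDiff ℝ (⊤ : ℕ∞) γ)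
    (c : ℂ) (m : ℕ) (coef : ℕ → ℂ) (hcm : coef m ≠ 0) :
    ∃ φ : ℝ → ℂ, ContDiff ℝ (⊤ : ℕ∞) φ ∧ HasCompactSupport φ ∧
      (∑ k ∈ Finset.range (m + 1),
          coef k * ((-1 : ℂ) ^ k *
            iteratedDeriv k
              (fun y : ℝ =>
                -4 * iteratedDeriv 2 (fun x : ℝ => (x : ℂ) * φ x) y
                  - 4 * (Complex.I * μ - 1) * deriv φ y
                  - 2 * deriv (fun x : ℝ => (x : ℂ) * γ x * φ x) y
                  + (c - Complex.I * μ) * γ y * φ y) 0)) ≠ 0 := by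
  let χ : ContDiffBump (0 : ℝ) := ⟨1, 2, one_pos, one_lt_two⟩
  have hχ : ContDiff ℝ ∞ (fun x : ℝ => ((χ x : ℝ) : ℂ)) := ofRealCLM.contDiff.comp χ.contDiff
  have hγ' : ContDiff ℝ ∞ (deriv γ) := (contDiff_infty_iff_deriv.1 hγ).2
  have hx : ContDiff ℝ ∞ (fun x : ℝ => (x : ℂ)) := ofRealCLM.contDiff
  refine ⟨fun x => (x : ℂ) ^ (m + 1) * (χ x : ℝ), (hx.pow _).mul hχ, ?_, ?_⟩
  · exact (χ.hasCompactSupport.comp_left (g := fun r : ℝ => (r : ℂ)) ofReal_zero).mul_left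
  let A : ℂ := -4 * ((m : ℂ) + 1) * ((m : ℂ) + 1 + I * μ)
  let g : ℝ → ℂ := fun x => A + (x : ℂ) *
    ((c - I * μ - 2 * ((m : ℂ) + 2)) * γ x - 2 * ((x : ℂ) * deriv γ x))
  have hg : ContDiff ℝ ∞ g := contDiff_const.add
    (hx.mul ((contDiff_const.mul hγ).sub (contDiff_const.mul (hx.mul hγ'))))
  have hA : A ≠ 0 := by
    refine mul_ne_zero (mul_ne_zero (by norm_num) (Nat.cast_add_one_ne_zero m)) fun h => ?_
    have hre := congrArg re h
    simp at hre
    have : (0 : ℝ) ≤ m := m.cast_nonneg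
    linarith
  have heq : ∀ k, iteratedDeriv k
      (fun y : ℝ =>
        -4 * iteratedDeriv 2 (fun x : ℝ => (x : ℂ) * ((x : ℂ) ^ (m + 1) * (χ x : ℝ))) y
          - 4 * (I * μ - 1) * deriv (fun x : ℝ => (x : ℂ) ^ (m + 1) * (χ x : ℝ)) y
          - 2 * deriv (fun x : ℝ => (x : ℂ) * γ x * ((x : ℂ) ^ (m + 1) * (χ x : ℝ))) y
          + (c - I * μ) * γ y * ((y : ℂ) ^ (m + 1) * (χ y : ℝ))) 0 =
      iteratedDeriv k (fun x : ℝ => (x : ℂ) ^ m * g x) 0 := by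
    intro k
    refine Filter.EventuallyEq.iteratedDeriv_eq k ?_
    filter_upwards [χ.eventuallyEq_one.eventuallyEq_nhds] with y hy
    have e1 : (fun x : ℝ => (x : ℂ) * ((x : ℂ) ^ (m + 1) * (χ x : ℝ))) =ᶠ[𝓝 y]
        fun x : ℝ => (x : ℂ) ^ (m + 1 + 1) := by
      filter_upwards [hy] with x hx1
      simp [hx1]
      ring
    have e2 : (fun x : ℝ => (x : ℂ) ^ (m + 1) * (χ x : ℝ)) =ᶠ[𝓝 y]
        fun x : ℝ => (x : ℂ) ^ (m + 1) := by
      filter_upwards [hy] with x hx1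
      simp [hx1]
    have e3 : (fun x : ℝ => (x : ℂ) * γ x * ((x : ℂ) ^ (m + 1) * (χ x : ℝ))) =ᶠ[𝓝 y]
        fun x : ℝ => (x : ℂ) ^ (m + 1 + 1) * γ x := by
      filter_upwards [hy] with x hx1
      simp [hx1]
      ring
    have d1 : iteratedDeriv 2 (fun x : ℝ => (x : ℂ) ^ (m + 1 + 1)) y =
        ((m : ℂ) + 2) * (((m : ℂ) + 1) * (y : ℂ) ^ m) := by
      rw [iteratedDeriv_succ', iteratedDeriv_one, funext (deriv_ofReal_pow (m + 1)),
        deriv_const_mul_field, deriv_ofReal_pow]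
      push_cast
      ring
    have d3 : deriv (fun x : ℝ => (x : ℂ) ^ (m + 1 + 1) * γ x) y =
        ((m : ℂ) + 2) * (y : ℂ) ^ (m + 1) * γ y + (y : ℂ) ^ (m + 1 + 1) * deriv γ y := by
      rw [deriv_fun_mul ((hx.pow _).differentiable (by simp) y)
        (hγ.differentiable (by simp) y), deriv_ofReal_pow]
      push_cast
      ring
    have hy1 : χ y = 1 := hy.eq_of_nhds
    rw [e1.iteratedDeriv_eq, e2.deriv_eq, e3.deriv_eq, d1, deriv_ofReal_pow, d3, hy1]
    simp only [g, A, ofReal_one]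
    ring
  simp only [heq]
  rw [Finset.sum_eq_single_of_mem m (by simp)]
  · rw [iteratedDeriv_ofReal_pow_mul_zero m m le_rfl g hg]
    have hg0 : g 0 = A := by simp [g]
    rw [if_pos rfl, hg0]
    exact mul_ne_zero hcm (mul_ne_zero (pow_ne_zero _ (by norm_num))
      (mul_ne_zero (Nat.cast_ne_zero.2 m.factorial_ne_zero) hA))
  · intro k hk hkm
    rw [iteratedDeriv_ofReal_pow_mul_zero k m (by simp at hk; omega) g hg, if_neg hkm]
    simp
end
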